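/- arXiv:2605.23540 — 3 statements merged into one kernel-verified Lean document; each statement's English description precedes it below -/
import Mathlib

section
/- Let G be a finite simple graph, v a vertex of G, and r, r' natural numbers with 1 < r ≤ r'. If v is not an r-step local articulation point of G (v ∉ LAP_r(G)), then v is not an r'-step local articulation point of G (v ∉ LAP_{r'}(G)). -/
/-- The `s`-step neighborhood of `v` in `G`: all vertices reachable from `v`
by a walk of length at most `s`. -/
def SimpleGraph.rBall {V : Type*} (G : SimpleGraph V) (v : V) (s : ℕ) : Set V :=
  {u | ∃ p : G.Walk v u, p.length ≤ s}

/-- The number of connected components of the subgraph of `G` induced on `S`. -/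
noncomputable def SimpleGraph.numComponentsOn {V : Type*} (G : SimpleGraph V) (S : Set V) : ℕ :=
  Nat.card (G.induce S).ConnectedComponent

/-- `v` is an `r`-step local articulation point of `G`: removing `v` from its
`r`-step induced neighborhood increases the number of connected components. -/
def SimpleGraph.IsLAP {V : Type*} (G : SimpleGraph V) (v : V) (r : ℕ) : Prop :=
  G.numComponentsOn (G.rBall v r) < G.numComponentsOn (G.rBall v r \ {v})


theorem SimpleGraph.rBall_mono {V : Type*} (G : SimpleGraph V) (v : V) {s t : ℕ} (h : s ≤ t) :
    G.rBall v s ⊆ G.rBall v t := fun _ ⟨p, hp⟩ => ⟨p, hp.trans h⟩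

theorem SimpleGraph.rBall_preconnected {V : Type*} (G : SimpleGraph V) (v : V) (s : ℕ) :
    (G.induce (G.rBall v s)).Preconnected := by
  classical
  have key : ∀ u : G.rBall v s,
      (G.induce (G.rBall v s)).Reachable ⟨v, ⟨SimpleGraph.Walk.nil, by simp⟩⟩ u := by
    rintro ⟨u, p, hp⟩
    exact ⟨p.induce (G.rBall v s) fun x hx =>
      ⟨p.takeUntil x hx, (p.length_takeUntil_le_length hx).trans hp⟩⟩
  exact fun a b => (key a).symm.trans (key b)

theorem SimpleGraph.rBall_diff_preconnected_succ {V : Type*} (G : SimpleGraph V) (v : V) (s : ℕ)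
    (hs : 1 ≤ s) (h : (G.induce (G.rBall v s \ {v})).Preconnected) :
    (G.induce (G.rBall v (s + 1) \ {v})).Preconnected := by
  have hsub : G.rBall v s \ {v} ⊆ G.rBall v (s + 1) \ {v} :=
    Set.diff_subset_diff_left (G.rBall_mono v (Nat.le_succ s))
  have key : ∀ u : ↥(G.rBall v (s + 1) \ {v}), ∃ x : ↥(G.rBall v s \ {v}),
      (G.induce (G.rBall v (s + 1) \ {v})).Reachable u ⟨x.1, hsub x.2⟩ := by
    rintro ⟨u, ⟨p, hp⟩, huv⟩
    by_cases hu : u ∈ G.rBall v s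
    · exact ⟨⟨u, hu, huv⟩, SimpleGraph.Reachable.refl _⟩
    · obtain ⟨q, hq⟩ : ∃ q : G.Walk u v, q.length ≤ s + 1 := ⟨p.reverse, by simpa using hp⟩
      cases q with
      | nil => exact absurd rfl huv
      | @cons _ x _ hadj q =>
        have hq' : q.length ≤ s := by simpa using hq
        have hx : x ∈ G.rBall v s := ⟨q.reverse, by simpa using hq'⟩
        have hxv : x ≠ v := by
          rintro rfl
          exact hu ⟨hadj.symm.toWalk, by simpa using hs⟩
        exact ⟨⟨x, hx, hxv⟩, SimpleGraph.Adj.reachable (by simpa using hadj)⟩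
  intro a b
  obtain ⟨x, hx⟩ := key a
  obtain ⟨y, hy⟩ := key b
  exact hx.trans (((h x y).map (SimpleGraph.induceHomOfLE G hsub).toHom).trans hy.symm)

theorem SimpleGraph.numComponentsOn_le_one_iff {V : Type*} [Finite V] (G : SimpleGraph V)
    (S : Set V) : G.numComponentsOn S ≤ 1 ↔ (G.induce S).Preconnected := by
  unfold SimpleGraph.numComponentsOn
  rw [Finite.card_le_one_iff_subsingleton]
  constructor
  · intro h a b
    exact SimpleGraph.ConnectedComponent.exact (Subsingleton.elim _ _)
  · intro h
    exact h.subsingleton_connectedComponent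

theorem SimpleGraph.isLAP_iff {V : Type*} [Finite V] (G : SimpleGraph V) (v : V) (s : ℕ) :
    ¬ G.IsLAP v s ↔ (G.induce (G.rBall v s \ {v})).Preconnected := by
  have h1 : G.numComponentsOn (G.rBall v s) = 1 := by
    apply le_antisymm ((G.numComponentsOn_le_one_iff _).2 (G.rBall_preconnected v s))
    have : Nonempty (G.induce (G.rBall v s)).ConnectedComponent :=
      ⟨SimpleGraph.connectedComponentMk _ ⟨v, ⟨SimpleGraph.Walk.nil, by simp⟩⟩⟩
    exact Finite.card_pos
  rw [← G.numComponentsOn_le_one_iff, SimpleGraph.IsLAP, h1, not_lt]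

theorem lap_antitone {V : Type*} [Fintype V] (G : SimpleGraph V) (v : V)
    (r r' : ℕ) (hr : 1 < r) (hrr' : r ≤ r')
    (h : ¬ G.IsLAP v r) : ¬ G.IsLAP v r' := by
  rw [SimpleGraph.isLAP_iff] at h ⊢
  induction r', hrr' using Nat.le_induction with
  | base => exact h
  | succ n hn ih => exact G.rBall_diff_preconnected_succ v n (by omega) ih
end

section
/- Let G be a finite simple graph, v a vertex of G, and r, r' natural numbers with 1 ≤ r ≤ r'. If the induced subgraph of G on B_r(v) \ {v} is connected, then the induced subgraph of G on B_{r'}(v) \ {v} is connected. -/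
theorem connected_deleted_ball_mono {V : Type*} [Fintype V] (G : SimpleGraph V) (v : V)
    (r r' : ℕ) (hr : 1 ≤ r) (hrr' : r ≤ r')
    (h : (G.induce (G.rBall v r \ {v})).Connected) :
    (G.induce (G.rBall v r' \ {v})).Connected := by
  induction r', hrr' using Nat.le_induction with
  | base => exact h
  | succ s hs ih =>
    have hsub : G.rBall v s \ {v} ⊆ G.rBall v (s + 1) \ {v} := by
      rintro u ⟨⟨p, hp⟩, hu⟩
      exact ⟨⟨p, by omega⟩, hu⟩
    have lift : ∀ a b : ↥(G.rBall v s \ {v}),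
        (G.induce (G.rBall v (s + 1) \ {v})).Reachable ⟨a, hsub a.2⟩ ⟨b, hsub b.2⟩ :=
      fun a b => (ih.preconnected a b).map (G.induceHomOfLE hsub).toHom
    have key : ∀ u : ↥(G.rBall v (s + 1) \ {v}), ∃ a : ↥(G.rBall v s \ {v}),
        (G.induce (G.rBall v (s + 1) \ {v})).Reachable u ⟨a, hsub a.2⟩ := by
      rintro ⟨u, hu⟩
      by_cases hus : u ∈ G.rBall v s
      · exact ⟨⟨u, hus, hu.2⟩, SimpleGraph.Reachable.refl _⟩
      · obtain ⟨⟨p, hp⟩, huv⟩ := id hu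
        have hnil : ¬ p.Nil := fun hn => huv (by simpa using hn.eq.symm)
        have hadj := p.adj_penultimate hnil
        have hlen : p.dropLast.length ≤ s := by
          have : p.dropLast.length + 1 = p.length := by
            simpa using p.length_dropLast_add_one hnil
          omega
        have hne : p.penultimate ≠ v := by
          intro he
          rw [he] at hadj
          exact hus ⟨hadj.toWalk, by simp; omega⟩
        refine ⟨⟨p.penultimate, ⟨p.dropLast, hlen⟩, hne⟩, SimpleGraph.Adj.reachable ?_⟩
        exact hadj.symm
    obtain ⟨a₀⟩ := ih.nonempty
    haveI : Nonempty ↥(G.rBall v (s + 1) \ {v}) := ⟨⟨a₀, hsub a₀.2⟩⟩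
    refine ⟨fun x y => ?_⟩
    obtain ⟨a, ha⟩ := key x
    obtain ⟨b, hb⟩ := key y
    exact ha.trans ((lift a b).trans hb.symm)
end

section
/- Let G be a connected finite simple graph with vertex set V, let D denote the diameter of G (the maximum shortest-path distance between any two vertices of G), and let r be a natural number with r ≥ max(D, 1). Then for every vertex v, one has v ∈ LAP_r(G) if and only if V \ {v} is nonempty and the induced subgraph of G on V \ {v} is not connected, i.e., the r-step local articulation points of G at any radius at least the diameter are exactly the (global) articulation points of G. -/
/-- For a connected finite graph `G` with diameter `D` and any radius
`r ≥ max D 1`, the `r`-step local articulation points of `G` are exactly the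
global articulation points: `v ∈ LAP_r(G)` iff `V \ {v}` is nonempty and the
subgraph of `G` induced on `V \ {v}` is not connected. -/
theorem isLAP_iff_articulation {V : Type*} [Fintype V] (G : SimpleGraph V)
    (hG : G.Connected) (r : ℕ) (hr : max G.diam 1 ≤ r) :
    ∀ v : V, G.IsLAP v r ↔
      ((Set.univ : Set V) \ {v}).Nonempty ∧
        ¬ (G.induce ((Set.univ : Set V) \ {v})).Connected := by
  intro v
  have hne : Nonempty V := ⟨v⟩
  have hball : G.rBall v r = Set.univ := by
    ext u
    simp only [SimpleGraph.rBall, Set.mem_setOf_eq, Set.mem_univ, iff_true]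
    obtain ⟨p, hp⟩ := hG.exists_walk_length_eq_dist v u
    refine ⟨p, ?_⟩
    have h := SimpleGraph.dist_le_diam
      (SimpleGraph.connected_iff_ediam_ne_top.mp hG) (u := v) (v := u)
    have := le_max_left G.diam 1
    omega
  have hone : G.numComponentsOn Set.univ = 1 := by
    have hc : (G.induce Set.univ).Connected := (SimpleGraph.induceUnivIso G).connected_iff.mpr hG
    unfold SimpleGraph.numComponentsOn
    rw [Nat.card_eq_one_iff_unique]
    exact ⟨hc.preconnected.subsingleton_connectedComponent,
      ⟨(G.induce Set.univ).connectedComponentMk ⟨v, trivial⟩⟩⟩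
  unfold SimpleGraph.IsLAP
  rw [hball, hone]
  unfold SimpleGraph.numComponentsOn
  generalize (Set.univ : Set V) \ {v} = S
  rw [Finite.one_lt_card_iff_nontrivial]
  constructor
  · intro h
    obtain ⟨c, d, hcd⟩ := h
    refine ⟨?_, fun hc => ?_⟩
    · induction c using SimpleGraph.ConnectedComponent.ind with
      | _ x => exact ⟨x.1, x.2⟩
    · have := hc.preconnected.subsingleton_connectedComponent
      exact hcd (Subsingleton.elim c d)
  · rintro ⟨⟨x, hx⟩, hc⟩
    by_contra h
    rw [not_nontrivial_iff_subsingleton] at h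
    apply hc
    have : Nonempty S := ⟨⟨x, hx⟩⟩
    refine ⟨fun a b => ?_⟩
    exact SimpleGraph.ConnectedComponent.exact (Subsingleton.elim _ _)
end
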